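/- Let b ∈ ℝ \ ℤ and let π : ℝ → ℝ be a nonnegative function that is valid and minimal for I_b. Then (i) π is subadditive, i.e., π(x) + π(y) ≥ π(x+y) for all x, y ∈ ℝ; (ii) π satisfies the symmetry condition π(x) + π(b − x) = 1 for every x ∈ ℝ; and (iii) π(z) = 0 for every z ∈ ℤ. -/

import Mathlib

/-- Membership in Gomory's infinite group model `I_b`. -/
def InIb (b : ℝ) (y : ℝ →₀ ℕ) : Prop :=
  ∃ z : ℤ, (∑ x ∈ y.support, (y x : ℝ) * x) - b = (z : ℝ)

/-- A function `π : ℝ → ℝ` is valid for `I_b`. -/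
def IsValid (b : ℝ) (π : ℝ → ℝ) : Prop :=
  ∀ y : ℝ →₀ ℕ, InIb b y → 1 ≤ ∑ x ∈ y.support, π x * (y x : ℝ)

/-- A (nonnegative valid) function `π` is minimal for `I_b` if it is not dominated by another
nonnegative valid function. -/
def IsMinimal (b : ℝ) (π : ℝ → ℝ) : Prop :=
  ¬ ∃ π' : ℝ → ℝ, (∀ x, 0 ≤ π' x) ∧ IsValid b π' ∧ (∀ x, π' x ≤ π x) ∧ π' ≠ π

theorem linearCombination_update_apply (f : ℝ → ℝ) (a v : ℝ) (w : ℝ →₀ ℕ) :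
    Finsupp.linearCombination ℕ (Function.update f a v) w =
      Finsupp.linearCombination ℕ f (w.erase a) + (w a : ℝ) * v := by
  conv_lhs => rw [← Finsupp.erase_add_single a w]
  have h : Finsupp.linearCombination ℕ (Function.update f a v) (w.erase a) =
      Finsupp.linearCombination ℕ f (w.erase a) := by
    refine Finset.sum_congr rfl fun x hx => ?_
    have hxa : x ≠ a := by
      rintro rfl
      simp at hx
    simp [hxa]
  simp [h]

theorem inIb_iff (b : ℝ) (w : ℝ →₀ ℕ) :
    InIb b w ↔ ∃ z : ℤ, Finsupp.linearCombination ℕ id w - b = (z : ℝ) := by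
  simp [InIb, Finsupp.linearCombination_apply, Finsupp.sum]

theorem isValid_iff (b : ℝ) (π : ℝ → ℝ) :
    IsValid b π ↔ ∀ w, InIb b w → 1 ≤ Finsupp.linearCombination ℕ π w := by
  simp [IsValid, Finsupp.linearCombination_apply, Finsupp.sum, mul_comm]

/-- A minimal function cannot be lowered at a single point while staying valid. -/
theorem IsMinimal.le_of_isValid_update {b : ℝ} {π : ℝ → ℝ} (hmin : IsMinimal b π)
    (hnn : ∀ x, 0 ≤ π x) {a v : ℝ} (hv : 0 ≤ v)
    (hval : IsValid b (Function.update π a v)) : π a ≤ v := by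
  by_contra! hlt
  refine hmin ⟨Function.update π a v, fun x => ?_, hval, fun x => ?_, fun h => ?_⟩
  · rcases eq_or_ne x a with rfl | hx
    · simpa using hv
    · simpa [hx] using hnn x
  · rcases eq_or_ne x a with rfl | hx
    · simpa using hlt.le
    · simp [hx]
  · have := congrFun h a
    simp only [Function.update_self] at this
    exact hlt.ne this

theorem IsMinimal.apply_intCast {b : ℝ} {π : ℝ → ℝ} (hmin : IsMinimal b π)
    (hnn : ∀ x, 0 ≤ π x) (hval : IsValid b π) (z : ℤ) : π z = 0 := by
  refine le_antisymm (hmin.le_of_isValid_update hnn le_rfl ?_) (hnn z)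
  rw [isValid_iff] at hval ⊢
  intro w hw
  rw [linearCombination_update_apply, mul_zero, add_zero]
  apply hval
  rw [inIb_iff] at hw ⊢
  obtain ⟨k, hk⟩ := hw
  refine ⟨k - w z * z, ?_⟩
  rw [← Finsupp.erase_add_single (z : ℝ) w, map_add, Finsupp.linearCombination_single,
    nsmul_eq_mul, id] at hk
  push_cast
  linarith

theorem IsMinimal.subadditive {b : ℝ} {π : ℝ → ℝ} (hmin : IsMinimal b π)
    (hnn : ∀ x, 0 ≤ π x) (hval : IsValid b π) (x y : ℝ) : π (x + y) ≤ π x + π y := by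
  refine hmin.le_of_isValid_update hnn (add_nonneg (hnn x) (hnn y)) ?_
  rw [isValid_iff] at hval ⊢
  intro w hw
  rw [linearCombination_update_apply]
  have h := hval (w.erase (x + y) + w (x + y) • (Finsupp.single x 1 + Finsupp.single y 1)) ?_
  · simpa [-smul_add, -Finsupp.smul_single] using h
  · rw [inIb_iff] at hw ⊢
    rw [← Finsupp.erase_add_single (x + y) w] at hw
    simpa [-smul_add, -Finsupp.smul_single] using hw

theorem apply_linearCombination_id_le {π : ℝ → ℝ} (h0 : π 0 = 0)
    (hsub : ∀ x y, π (x + y) ≤ π x + π y) (w : ℝ →₀ ℕ) :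
    π (Finsupp.linearCombination ℕ id w) ≤ Finsupp.linearCombination ℕ π w := by
  have hmul (x : ℝ) (n : ℕ) : π (n * x) ≤ n * π x := by
    induction n with
    | zero => simp [h0]
    | succ n ih =>
      have := hsub (n * x) x
      push_cast
      rw [add_one_mul, add_one_mul]
      linarith
  induction w using Finsupp.induction_linear with
  | zero => simp [h0]
  | add f g hf hg =>
    simp only [map_add]
    exact (hsub _ _).trans (add_le_add hf hg)
  | single x n => simpa using hmul x n

theorem IsMinimal.add_apply_sub_le_one {b : ℝ} {π : ℝ → ℝ} (hmin : IsMinimal b π)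
    (hnn : ∀ x, 0 ≤ π x) (hval : IsValid b π) {x : ℝ} (hx : 0 < π x) :
    π x + π (b - x) ≤ 1 := by
  have hint := hmin.apply_intCast hnn hval
  have hsub := hmin.subadditive hnn hval
  have h0 : π 0 = 0 := by simpa using hint 0
  by_contra! hgt
  set c := π x + π (b - x) with hc
  have hc0 : 0 < c := by linarith
  refine absurd (hmin.le_of_isValid_update hnn (a := x) (v := π x / c) (by positivity) ?_)
    (not_le.2 (div_lt_self hx hgt))
  rw [isValid_iff] at hval ⊢
  intro w hw
  rw [linearCombination_update_apply]
  have hsplit : Finsupp.linearCombination ℕ π w =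
      Finsupp.linearCombination ℕ π (w.erase x) + w x * π x := by
    conv_lhs => rw [← Finsupp.erase_add_single x w]
    simp
  have hrest : 0 ≤ Finsupp.linearCombination ℕ π (w.erase x) :=
    Finset.sum_nonneg fun y _ => nsmul_nonneg (hnn y) _
  rcases Nat.eq_zero_or_pos (w x) with hwx | hwx
  · have := hval w hw
    rw [hsplit] at this
    simpa [hwx] using this
  have hle : c ≤ Finsupp.linearCombination ℕ π w := by
    obtain ⟨v, hv⟩ : ∃ v, w = v + Finsupp.single x 1 :=
      ⟨w - Finsupp.single x 1, (tsub_add_cancel_of_le (Finsupp.single_le_iff.2 hwx)).symm⟩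
    obtain ⟨k, hk⟩ := (inIb_iff _ _).1 hw
    have h1 := apply_linearCombination_id_le h0 hsub v
    have h2 := hsub (Finsupp.linearCombination ℕ id v) ((-k : ℤ) : ℝ)
    have h3 : Finsupp.linearCombination ℕ id v + ((-k : ℤ) : ℝ) = b - x := by
      simp only [hv, map_add, Finsupp.linearCombination_single, one_smul, id] at hk
      push_cast
      linarith
    rw [h3, hint] at h2
    simp only [hv, map_add, Finsupp.linearCombination_single, one_smul]
    linarith
  rw [hsplit] at hle
  have : Finsupp.linearCombination ℕ π (w.erase x) / c ≤
      Finsupp.linearCombination ℕ π (w.erase x) := div_le_self hrest hgt.le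
  calc 1 ≤ (Finsupp.linearCombination ℕ π (w.erase x) + w x * π x) / c := (one_le_div hc0).2 hle
    _ = Finsupp.linearCombination ℕ π (w.erase x) / c + w x * (π x / c) := by ring
    _ ≤ _ := by gcongr

theorem IsValid.one_le_add_apply_sub {b : ℝ} {π : ℝ → ℝ} (hval : IsValid b π) (x : ℝ) :
    1 ≤ π x + π (b - x) := by
  rw [isValid_iff] at hval
  have h := hval (Finsupp.single x 1 + Finsupp.single (b - x) 1)
    ((inIb_iff _ _).2 ⟨0, by simp⟩)
  rwa [map_add, Finsupp.linearCombination_single, Finsupp.linearCombination_single, one_smul,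
    one_smul] at h

theorem minimal_characterization_forward (b : ℝ) (hb : ∀ z : ℤ, b ≠ (z : ℝ))
    (π : ℝ → ℝ) (hnn : ∀ x, 0 ≤ π x) (hval : IsValid b π) (hmin : IsMinimal b π) :
    (∀ x y : ℝ, π (x + y) ≤ π x + π y) ∧
    (∀ x : ℝ, π x + π (b - x) = 1) ∧
    (∀ z : ℤ, π (z : ℝ) = 0) := by
  refine ⟨hmin.subadditive hnn hval, fun x => ?_, hmin.apply_intCast hnn hval⟩
  have hge := hval.one_le_add_apply_sub x
  refine le_antisymm ?_ hge
  rcases (hnn x).eq_or_lt with hx | hx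
  · have h := hmin.add_apply_sub_le_one hnn hval (x := b - x) (by linarith)
    rw [sub_sub_cancel] at h
    linarith
  · exact hmin.add_apply_sub_le_one hnn hval hx
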